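/- Let a ∈ ℚ and let Y ∈ ℚ[[X]] be the unique power series with constant coefficient 0 satisfying Y² − aX·Y − Y = X³ − X. Set G := X·(1 − Y)⁻¹, a power series of order 1 whose linear coefficient is 1, and let W be the compositional inverse of G, i.e., the unique power series with constant coefficient 0 such that W(G(X)) = X and G(W(X)) = X. Then (1 + aX − 2X²·W)² = 1 + 2aX + a²X² − 4X³ + 4(1−a)X⁴. (This is the reversion step in the passage from the elliptic curve y² − axy − y = x³ − x to its associated Riordan pseudo-involution: the reverted series equals (1 + ax − √(1 + 2ax + a²x² − 4x³ + 4(1−a)x⁴))/(2x²).) -/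

import Mathlib

open PowerSeries

/-- Substitution of the power series `f` (intended: with zero constant coefficient) into the
power series `g`: the `n`-th coefficient of `g(f)` is `∑_{k=0}^{n} gₖ · [Xⁿ] fᵏ`. -/
noncomputable def substSeries (f g : PowerSeries ℚ) : PowerSeries ℚ :=
  PowerSeries.mk fun n => ∑ k ∈ Finset.range (n + 1), coeff k g * coeff n (f ^ k)

lemma substSeries_eq_subst (f g : PowerSeries ℚ) (hf : constantCoeff f = 0) :
    substSeries f g = g.subst f := by
  ext n
  rw [coeff_subst' (HasSubst.of_constantCoeff_zero' hf), substSeries, coeff_mk]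
  rw [finsum_eq_sum_of_support_subset (s := Finset.range (n + 1))]
  · simp [smul_eq_mul]
  · intro k hk
    by_contra h
    apply hk
    have hlt : n < k := by simpa using h
    have : coeff n (f ^ k) = 0 := by
      have hd : X ^ k ∣ f ^ k := pow_dvd_pow_of_dvd (X_dvd_iff.mpr hf) k
      exact X_pow_dvd_iff.mp hd n hlt
    simp [this]

/-- Let `Y` be the power series with constant coefficient `0` satisfying
`Y² − aX·Y − Y = X³ − X`, let `G := X·(1 − Y)⁻¹`, and let `W` be the compositional inverse
of `G` (the unique power series with zero constant coefficient with `W(G(X)) = X` and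
`G(W(X)) = X`).  Then `(1 + aX − 2X²·W)² = 1 + 2aX + a²X² − 4X³ + 4(1−a)X⁴`. -/
theorem stmt_14 (a : ℚ) (Y : PowerSeries ℚ)
    (hY0 : constantCoeff Y = 0)
    (hY : Y ^ 2 - C a * X * Y - Y = X ^ 3 - X)
    (W : PowerSeries ℚ) (hW0 : constantCoeff W = 0)
    (hWG : substSeries (X * (1 - Y)⁻¹) W = X)
    (hGW : substSeries W (X * (1 - Y)⁻¹) = X) :
    (1 + C a * X - 2 * X ^ 2 * W) ^ 2 =
      1 + 2 * C a * X + C a ^ 2 * X ^ 2 - 4 * X ^ 3 + 4 * C (1 - a) * X ^ 4 := by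
  have hs : HasSubst W := HasSubst.of_constantCoeff_zero' hW0
  have hWne : W ≠ 0 := by
    rintro rfl
    have h1 := congrArg (coeff 1) hWG
    simp [substSeries] at h1
  rw [substSeries_eq_subst _ _ hW0] at hGW
  have hinv : (1 - Y)⁻¹ * (1 - Y) = 1 := PowerSeries.inv_mul_cancel _ (by simp [hY0])
  let φ : PowerSeries ℚ →ₐ[ℚ] PowerSeries ℚ := substAlgHom hs
  have hφ : ∀ f, φ f = f.subst W := fun f => by
    rw [← coe_substAlgHom hs]
  have hφX : φ X = W := by rw [hφ]; exact subst_X hs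
  have hφC : φ (C a) = C a := by rw [hφ]; exact subst_C a
  have hG : φ (X * (1 - Y)⁻¹) = X := by rw [hφ]; exact hGW
  have e1 : X * (1 - φ Y) = W := by
    rw [← hG, ← hφX]
    have : φ ((X * (1 - Y)⁻¹) * (1 - Y)) = φ X := by
      rw [mul_assoc, hinv, mul_one]
    rw [map_mul, map_sub, map_one] at this
    exact this
  have e2 := congrArg φ hY
  simp only [map_sub, map_mul, map_pow, hφX, hφC] at e2
  have e3 : W * (X ^ 2 * W ^ 2 - (1 + C a * X) * W + X * (1 + C a * X) - X ^ 2) = 0 := by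
    generalize φ Y = V at e1 e2
    subst e1
    linear_combination (-X ^ 2) * e2
  have e4 := (mul_eq_zero.mp e3).resolve_left hWne
  have e5 : C (1 - a) = 1 - C a := by simp
  rw [e5]
  linear_combination 4 * X ^ 2 * e4
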